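/- arXiv:2511.16195 — 4 statements merged into one kernel-verified Lean document; each statement's English description precedes it below -/
import Mathlib

section
/- Let r, m ∈ ℕ with m ≤ r (equivalently ν = r + 1/2 > m), let σ > 0, ℓ > 0, and let k_{r+1/2} be the half-integer Matérn kernel. Then the linear span of the kernel sections {t ↦ k_{r+1/2}(t, s) : s ∈ ℝ} is dense in C^m([a,b]) for every a < b: for every f : ℝ → ℝ of class C^m and every ε > 0 there exist N ∈ ℕ, coefficients c₁,…,c_N ∈ ℝ and points s₁,…,s_N ∈ ℝ such that for every j ≤ m and every t ∈ [a,b], |f^{(j)}(t) − Σ_{i=1}^N c_i · ∂_t^j k_{r+1/2}(t, s_i)| < ε. (This expresses Theorem 1 of the paper: the RKHS of the Matérn kernel, which is the closure of the span of its kernel sections and embeds continuously into C^m, is dense in C^m.) -/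
open Real Finset

/-- The half-integer Matérn kernel with parameters `σ > 0`, `ℓ > 0` and `ν = r + 1/2`. -/
noncomputable def maternKernel (r : ℕ) (σ ℓ : ℝ) (t t' : ℝ) : ℝ :=
  σ ^ 2 * Real.exp (-(Real.sqrt (2 * r + 1) * |t - t'| / ℓ)) *
    ((r.factorial : ℝ) / ((2 * r).factorial : ℝ)) *
    ∑ i ∈ Finset.range (r + 1),
      (((r + i).factorial : ℝ) / ((i.factorial : ℝ) * ((r - i).factorial : ℝ))) *
        (2 * Real.sqrt (2 * r + 1) * |t - t'| / ℓ) ^ (r - i)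


open Polynomial in
/-- The polynomial `∑ₖ (2r - k)! / ((r - k)! k!) Xᵏ`, a reverse Bessel polynomial in `X / 2`. -/
noncomputable def besselPolynomial (r : ℕ) : ℝ[X] :=
  ∑ k ∈ range (r + 1),
    monomial k (((2 * r - k).factorial : ℝ) / ((r - k).factorial * k.factorial))

lemma besselPolynomial_coeff_of_le {r k : ℕ} (h : k ≤ r) :
    (besselPolynomial r).coeff k =
      ((2 * r - k).factorial : ℝ) / ((r - k).factorial * k.factorial) := by
  simp [besselPolynomial, Polynomial.coeff_monomial, h]

lemma besselPolynomial_coeff_of_lt {r k : ℕ} (h : r < k) :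
    (besselPolynomial r).coeff k = 0 := by
  simp [besselPolynomial, Polynomial.coeff_monomial, h]

/-- `2 θ_{r+1}' = θ_{r+1} - X θ_r`. -/
lemma two_mul_derivative_besselPolynomial_succ (r : ℕ) :
    2 * Polynomial.derivative (besselPolynomial (r + 1)) =
      besselPolynomial (r + 1) - Polynomial.X * besselPolynomial r := by
  ext k
  rw [Polynomial.coeff_sub, Polynomial.coeff_ofNat_mul, Polynomial.coeff_derivative]
  rcases k with _ | k
  · rw [besselPolynomial_coeff_of_le (by omega), besselPolynomial_coeff_of_le (by omega)]
    have h1 : (2 * (r + 1) - 0) = (2 * r + 1) + 1 := by omega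
    have h2 : (2 * (r + 1) - (0 + 1)) = 2 * r + 1 := by omega
    rw [h1, h2, Nat.factorial_succ (2 * r + 1)]
    simp only [Polynomial.coeff_X_mul_zero, Nat.add_sub_cancel, Nat.sub_zero, zero_add,
      Nat.factorial_one, Nat.factorial_zero, Nat.factorial_succ r]
    have := r.factorial_ne_zero
    push_cast
    field_simp
    ring
  · rw [Polynomial.coeff_X_mul]
    rcases lt_trichotomy k r with h | rfl | h
    · obtain ⟨n, rfl⟩ := Nat.exists_eq_add_of_lt h
      rw [besselPolynomial_coeff_of_le (by omega), besselPolynomial_coeff_of_le (by omega),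
        besselPolynomial_coeff_of_le (by omega)]
      have h1 : 2 * (k + n + 1 + 1) - (k + 1 + 1) = k + 2 * n + 2 := by omega
      have h2 : 2 * (k + n + 1 + 1) - (k + 1) = k + 2 * n + 2 + 1 := by omega
      have h3 : 2 * (k + n + 1) - k = k + 2 * n + 2 := by omega
      have h4 : k + n + 1 + 1 - (k + 1 + 1) = n := by omega
      have h5 : k + n + 1 + 1 - (k + 1) = n + 1 := by omega
      have h6 : k + n + 1 - k = n + 1 := by omega
      rw [h1, h2, h3, h4, h5, h6]
      simp only [Nat.factorial_succ k, Nat.factorial_succ (k + 1), Nat.factorial_succ n,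
        Nat.factorial_succ (k + 2 * n + 2)]
      have := k.factorial_ne_zero
      have := n.factorial_ne_zero
      push_cast
      field_simp
      ring
    · rw [besselPolynomial_coeff_of_lt (by omega), besselPolynomial_coeff_of_le (by omega),
        besselPolynomial_coeff_of_le (by omega)]
      have h1 : 2 * (k + 1) - (k + 1) = k + 1 := by omega
      have h2 : 2 * k - k = k := by omega
      rw [h1, h2]
      have := k.factorial_ne_zero
      have := (k + 1).factorial_ne_zero
      simp only [Nat.sub_self, Nat.factorial_zero]
      push_cast
      field_simp
      ring
    · rw [besselPolynomial_coeff_of_lt (by omega), besselPolynomial_coeff_of_lt (by omega),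
        besselPolynomial_coeff_of_lt (by omega)]
      simp

/-- `2 X θ_r' = (4r + 2 + X) θ_r - θ_{r+1}`. -/
lemma two_mul_X_mul_derivative_besselPolynomial (r : ℕ) :
    2 * (Polynomial.X * Polynomial.derivative (besselPolynomial r)) =
      Polynomial.C (4 * (r : ℝ) + 2) * besselPolynomial r + Polynomial.X * besselPolynomial r -
        besselPolynomial (r + 1) := by
  ext k
  rw [Polynomial.coeff_sub, Polynomial.coeff_ofNat_mul, Polynomial.coeff_add,
    Polynomial.coeff_C_mul]
  rcases k with _ | k
  · rw [besselPolynomial_coeff_of_le (by omega), besselPolynomial_coeff_of_le (by omega)]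
    have h1 : (2 * (r + 1) - 0) = (2 * r + 1) + 1 := by omega
    rw [h1, Nat.factorial_succ (2 * r + 1), Nat.factorial_succ (2 * r)]
    simp only [Polynomial.coeff_X_mul_zero, Nat.sub_zero,
      Nat.factorial_zero, Nat.factorial_succ r]
    have := r.factorial_ne_zero
    push_cast
    field_simp
    ring
  · rw [Polynomial.coeff_X_mul, Polynomial.coeff_X_mul, Polynomial.coeff_derivative]
    rcases lt_trichotomy k r with h | rfl | h
    · obtain ⟨n, rfl⟩ := Nat.exists_eq_add_of_lt h
      rw [besselPolynomial_coeff_of_le (by omega), besselPolynomial_coeff_of_le (by omega),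
        besselPolynomial_coeff_of_le (by omega)]
      have h1 : 2 * (k + n + 1) - (k + 1) = k + 2 * n + 1 := by omega
      have h2 : 2 * (k + n + 1 + 1) - (k + 1) = k + 2 * n + 1 + 1 + 1 := by omega
      have h3 : 2 * (k + n + 1) - k = k + 2 * n + 1 + 1 := by omega
      have h4 : k + n + 1 - (k + 1) = n := by omega
      have h5 : k + n + 1 + 1 - (k + 1) = n + 1 := by omega
      have h6 : k + n + 1 - k = n + 1 := by omega
      rw [h1, h2, h3, h4, h5, h6]
      simp only [Nat.factorial_succ k, Nat.factorial_succ n,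
        Nat.factorial_succ (k + 2 * n + 1), Nat.factorial_succ (k + 2 * n + 1 + 1)]
      have := k.factorial_ne_zero
      have := n.factorial_ne_zero
      push_cast
      field_simp
      ring
    · rw [besselPolynomial_coeff_of_lt (by omega), besselPolynomial_coeff_of_le (by omega),
        besselPolynomial_coeff_of_le (by omega)]
      have h1 : 2 * (k + 1) - (k + 1) = k + 1 := by omega
      have h2 : 2 * k - k = k := by omega
      rw [h1, h2]
      have := k.factorial_ne_zero
      have := (k + 1).factorial_ne_zero
      simp only [Nat.sub_self, Nat.factorial_zero]
      push_cast
      field_simp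
      ring
    · rw [besselPolynomial_coeff_of_lt (by omega), besselPolynomial_coeff_of_lt (by omega),
        besselPolynomial_coeff_of_lt (by omega)]
      simp

/-- The Matérn kernel with inverse length scale `lam`, as a function of `t - t'` and up to a
constant factor. -/
noncomputable def maternProfile (lam : ℝ) (r : ℕ) (x : ℝ) : ℝ :=
  Real.exp (-(lam * |x|)) * (besselPolynomial r).eval (2 * (lam * |x|))

lemma continuous_maternProfile (lam : ℝ) (r : ℕ) : Continuous (maternProfile lam r) := by
  unfold maternProfile
  have := (besselPolynomial r).continuous
  fun_prop

lemma hasDerivAt_maternProfile_of_ne (lam : ℝ) (r : ℕ) {x : ℝ} (hx : x ≠ 0) :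
    HasDerivAt (maternProfile lam r)
      (lam * SignType.sign x * Real.exp (-(lam * |x|)) *
        (2 * (Polynomial.derivative (besselPolynomial r)).eval (2 * (lam * |x|)) -
          (besselPolynomial r).eval (2 * (lam * |x|)))) x := by
  have h := (hasDerivAt_abs hx).const_mul lam
  convert! h.neg.exp.mul (((besselPolynomial r).hasDerivAt _).comp x (h.const_mul 2)) using 1
  simp only [Pi.neg_apply, Function.comp_apply]
  ring

lemma hasDerivAt_maternProfile_succ (lam : ℝ) (r : ℕ) (x : ℝ) :
    HasDerivAt (maternProfile lam (r + 1)) (-2 * lam ^ 2 * (x * maternProfile lam r x)) x := by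
  refine hasDerivAt_of_hasDerivAt_of_ne' (x := 0)
    (g := fun x => -2 * lam ^ 2 * (x * maternProfile lam r x)) (fun y hy => ?_)
    (continuous_maternProfile lam (r + 1)).continuousAt
    (continuous_const.mul (continuous_id.mul (continuous_maternProfile lam r))).continuousAt x
  convert! hasDerivAt_maternProfile_of_ne lam (r + 1) hy using 1
  have h := congrArg (Polynomial.eval (2 * (lam * |y|)))
    (two_mul_derivative_besselPolynomial_succ r)
  simp only [Polynomial.eval_mul, Polynomial.eval_ofNat, Polynomial.eval_sub,
    Polynomial.eval_X] at h
  rw [h, maternProfile]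
  linear_combination (2 * lam ^ 2 * Real.exp (-(lam * |y|)) *
    (besselPolynomial r).eval (2 * (lam * |y|))) * (sign_mul_abs y)

lemma hasDerivAt_mul_maternProfile (lam : ℝ) (r : ℕ) (x : ℝ) :
    HasDerivAt (fun x => x * maternProfile lam r x)
      ((2 * r + 2) * maternProfile lam r x - maternProfile lam (r + 1) x / 2) x := by
  refine hasDerivAt_of_hasDerivAt_of_ne' (x := 0)
    (g := fun x => (2 * r + 2) * maternProfile lam r x - maternProfile lam (r + 1) x / 2)
    (fun y hy => ?_)
    (continuous_id.mul (continuous_maternProfile lam r)).continuousAt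
    ((continuous_const.mul (continuous_maternProfile lam r)).sub
      ((continuous_maternProfile lam (r + 1)).div_const 2)).continuousAt x
  convert! (hasDerivAt_id y).mul (hasDerivAt_maternProfile_of_ne lam r hy) using 1
  have h := congrArg (Polynomial.eval (2 * (lam * |y|)))
    (two_mul_X_mul_derivative_besselPolynomial r)
  simp only [Polynomial.eval_mul, Polynomial.eval_ofNat, Polynomial.eval_sub,
    Polynomial.eval_add, Polynomial.eval_C, Polynomial.eval_X] at h
  have hs : (SignType.sign y : ℝ) * y = |y| := sign_mul_self y
  simp only [maternProfile, id]
  linear_combination (-(1 / 2) * Real.exp (-(lam * |y|))) * h -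
    lam * Real.exp (-(lam * |y|)) *
      (2 * (Polynomial.derivative (besselPolynomial r)).eval (2 * (lam * |y|)) -
          (besselPolynomial r).eval (2 * (lam * |y|))) * hs

lemma contDiff_maternProfile (lam : ℝ) (r : ℕ) : ContDiff ℝ r (maternProfile lam r) := by
  induction r with
  | zero => exact contDiff_zero.2 (continuous_maternProfile lam 0)
  | succ r ih =>
    push_cast
    rw [contDiff_succ_iff_deriv]
    refine ⟨fun x => (hasDerivAt_maternProfile_succ lam r x).differentiableAt, by simp, ?_⟩
    rw [funext fun x => (hasDerivAt_maternProfile_succ lam r x).deriv]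
    exact contDiff_const.mul (contDiff_id.mul ih)

open MeasureTheory in
lemma integrable_comp_const_sub_mul {K h : ℝ → ℝ} (hK : Continuous K) (hh : Continuous h)
    (hc : HasCompactSupport h) (t : ℝ) : Integrable fun s => K (t - s) * h s :=
  ((hK.comp (continuous_const.sub continuous_id)).mul hh).integrable_of_hasCompactSupport
    hc.mul_left

open MeasureTheory in
lemma integral_deriv_comp_const_sub_mul {K K' h : ℝ → ℝ} (hK : ∀ x, HasDerivAt K (K' x) x)
    (hK' : Continuous K') (hh : ContDiff ℝ 1 h) (hc : HasCompactSupport h) (t : ℝ) :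
    ∫ s, K' (t - s) * h s = ∫ s, K (t - s) * deriv h s := by
  have hKc : Continuous K := continuous_iff_continuousAt.2 fun x => (hK x).continuousAt
  have hu : ∀ s, HasDerivAt (fun s => K (t - s)) (-K' (t - s)) s := fun s =>
    (hK (t - s)).comp_const_sub t s
  have hv : ∀ s, HasDerivAt h (deriv h s) s := fun s =>
    (hh.differentiable one_ne_zero s).hasDerivAt
  rw [integral_mul_deriv_eq_deriv_mul_of_integrable (fun s _ => hu s) (fun s _ => hv s)
    (integrable_comp_const_sub_mul hKc (hh.continuous_deriv le_rfl) hc.deriv t)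
    (((integrable_comp_const_sub_mul hK' hh.continuous hc t).neg).congr (.of_forall fun s => by simp))
    (integrable_comp_const_sub_mul hKc hh.continuous hc t)]
  simp [integral_neg]

open MeasureTheory in
lemma hasDerivAt_integral_comp_const_sub_mul {K h : ℝ → ℝ} (hK : Continuous K)
    (hh : ContDiff ℝ 1 h) (hc : HasCompactSupport h) (t : ℝ) :
    HasDerivAt (fun t => ∫ s, K (t - s) * h s) (∫ s, K (t - s) * deriv h s) t := by
  have h1 := hc.hasDerivAt_convolution_right (ContinuousLinearMap.mul ℝ ℝ)
    (hK.locallyIntegrable (μ := volume)) hh t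
  have h2 : ∀ (g : ℝ → ℝ) (t : ℝ), convolution K g (ContinuousLinearMap.mul ℝ ℝ) volume t =
      ∫ s, K (t - s) * g s := fun g t => by
    rw [convolution_def, ← integral_sub_left_eq_self _ _ t]
    simp
  rw [h2] at h1
  exact h1.congr_of_eventuallyEq (.of_forall fun t => (h2 h t).symm)

open MeasureTheory in
lemma iteratedDeriv_integral_comp_const_sub_mul {K h : ℝ → ℝ} {j : ℕ} (hK : ContDiff ℝ j K)
    (hh : ContDiff ℝ 1 h) (hc : HasCompactSupport h) (t : ℝ) :
    iteratedDeriv j (fun t => ∫ s, K (t - s) * h s) t =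
      ∫ s, iteratedDeriv j K (t - s) * h s := by
  induction j generalizing K with
  | zero => simp
  | succ j ih =>
    push_cast at hK
    have hK1 : ContDiff ℝ 1 K := hK.of_le (by simp)
    rw [iteratedDeriv_succ', iteratedDeriv_succ', ← ih (contDiff_succ_iff_deriv.1 hK).2.2]
    congr 1
    ext t
    rw [(hasDerivAt_integral_comp_const_sub_mul hK.continuous hh hc t).deriv,
      integral_deriv_comp_const_sub_mul
        (fun x => (hK1.differentiable one_ne_zero x).hasDerivAt)
        (hK1.continuous_deriv le_rfl) hh hc]

open MeasureTheory in
lemma integral_maternProfile_succ (lam : ℝ) (r : ℕ) {h : ℝ → ℝ} (hh : ContDiff ℝ 2 h)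
    (hc : HasCompactSupport h) (t : ℝ) :
    ∫ s, maternProfile lam (r + 1) (t - s) * (lam ^ 2 * h s - deriv (deriv h) s) =
      4 * (r + 1) * lam ^ 2 * ∫ s, maternProfile lam r (t - s) * h s := by
  have hh' : ContDiff ℝ 1 (deriv h) := (contDiff_succ_iff_deriv (n := 1) |>.1 hh).2.2
  have hM := continuous_maternProfile lam
  have hh1 : ContDiff ℝ 1 h := hh.of_le (by norm_num)
  have e1 : ∫ s, maternProfile lam (r + 1) (t - s) * deriv (deriv h) s =
      ∫ s, -2 * lam ^ 2 * ((2 * r + 2) * maternProfile lam r (t - s) -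
        maternProfile lam (r + 1) (t - s) / 2) * h s := by
    rw [← integral_deriv_comp_const_sub_mul (hasDerivAt_maternProfile_succ lam r)
        (continuous_const.mul (continuous_id.mul (hM r))) hh' hc.deriv,
      ← integral_deriv_comp_const_sub_mul
        (fun x => (hasDerivAt_mul_maternProfile lam r x).const_mul (-2 * lam ^ 2))
        (continuous_const.mul ((continuous_const.mul (hM r)).sub ((hM (r + 1)).div_const 2)))
        hh1 hc]
  have i1 := integrable_comp_const_sub_mul (hM (r + 1)) hh.continuous hc t
  have i0 := integrable_comp_const_sub_mul (hM r) hh.continuous hc t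
  have i2 := integrable_comp_const_sub_mul (hM (r + 1)) (hh'.continuous_deriv le_rfl)
    hc.deriv.deriv t
  have e2 : (fun s => maternProfile lam (r + 1) (t - s) * (lam ^ 2 * h s - deriv (deriv h) s)) =
      fun s => lam ^ 2 * (maternProfile lam (r + 1) (t - s) * h s) -
        maternProfile lam (r + 1) (t - s) * deriv (deriv h) s := by
    ext s; ring
  have e3 : (fun s => -2 * lam ^ 2 * ((2 * r + 2) * maternProfile lam r (t - s) -
        maternProfile lam (r + 1) (t - s) / 2) * h s) =
      fun s => lam ^ 2 * (maternProfile lam (r + 1) (t - s) * h s) -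
        4 * (r + 1) * lam ^ 2 * (maternProfile lam r (t - s) * h s) := by
    ext s; ring
  rw [e2, integral_sub (i1.const_mul _) i2, e1, e3, integral_sub (i1.const_mul _)
    (i0.const_mul _), integral_const_mul, integral_const_mul]
  ring

open MeasureTheory Set in
lemma integral_maternProfile_zero (lam : ℝ) {h : ℝ → ℝ} (hh : ContDiff ℝ 2 h)
    (hc : HasCompactSupport h) (t : ℝ) :
    ∫ s, maternProfile lam 0 (t - s) * (lam ^ 2 * h s - deriv (deriv h) s) =
      2 * lam * h t := by
  have hh' : ContDiff ℝ 1 (deriv h) := (contDiff_succ_iff_deriv (n := 1) |>.1 hh).2.2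
  have hh1 : ContDiff ℝ 1 h := hh.of_le (by norm_num)
  have hint : Integrable fun s =>
      maternProfile lam 0 (t - s) * (lam ^ 2 * h s - deriv (deriv h) s) :=
    integrable_comp_const_sub_mul (continuous_maternProfile lam 0)
      ((continuous_const.mul hh.continuous).sub (hh'.continuous_deriv le_rfl))
      (hc.mul_left.sub hc.deriv.deriv) t
  have hP : ∀ x, maternProfile lam 0 x = Real.exp (-(lam * |x|)) := fun x => by
    simp [maternProfile, besselPolynomial]
  have hexp : ∀ (d : ℝ) (s : ℝ),
      HasDerivAt (fun s => Real.exp (d * (s - t)) * (d * h s - deriv h s))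
        (Real.exp (d * (s - t)) * (d ^ 2 * h s - deriv (deriv h) s)) s := fun d s => by
    have h1 := (hh1.differentiable one_ne_zero s).hasDerivAt
    have h2 := (hh'.differentiable one_ne_zero s).hasDerivAt
    convert! (((hasDerivAt_id s).sub_const t).const_mul d).exp.mul ((h1.const_mul d).sub h2)
      using 1
    simp only [id, Pi.sub_apply]
    ring
  have hsmooth : ∀ d : ℝ,
      ContDiff ℝ 1 (fun s => Real.exp (d * (s - t)) * (d * h s - deriv h s)) := fun d => by
    fun_prop
  have hcs : ∀ d : ℝ,
      HasCompactSupport (fun s => Real.exp (d * (s - t)) * (d * h s - deriv h s)) := fun d =>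
    (hc.mul_left.sub hc.deriv).mul_left
  rw [← intervalIntegral.integral_Iic_add_Ioi hint.integrableOn hint.integrableOn (b := t)]
  have e1 := (hcs lam).integral_Iic_deriv_eq (hsmooth lam) t
  have e2 := (hcs (-lam)).integral_Ioi_deriv_eq (hsmooth (-lam)) t
  rw [funext fun s => (hexp lam s).deriv] at e1
  rw [funext fun s => (hexp (-lam) s).deriv] at e2
  have e3 : ∫ s in Iic t, maternProfile lam 0 (t - s) * (lam ^ 2 * h s - deriv (deriv h) s) =
      ∫ s in Iic t, Real.exp (lam * (s - t)) * (lam ^ 2 * h s - deriv (deriv h) s) := by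
    refine setIntegral_congr_fun measurableSet_Iic fun s hs => ?_
    simp only [hP, abs_of_nonneg (sub_nonneg.2 (mem_Iic.1 hs))]
    congr 2; ring
  have e4 : ∫ s in Ioi t, maternProfile lam 0 (t - s) * (lam ^ 2 * h s - deriv (deriv h) s) =
      ∫ s in Ioi t, Real.exp (-lam * (s - t)) * ((-lam) ^ 2 * h s - deriv (deriv h) s) := by
    refine setIntegral_congr_fun measurableSet_Ioi fun s hs => ?_
    simp only [hP, abs_of_neg (sub_neg.2 (mem_Ioi.1 hs)), neg_sq]
    congr 2; ring
  rw [e3, e4, e1, e2]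
  simp only [sub_self, mul_zero, Real.exp_zero]
  ring

open MeasureTheory in
open scoped ContDiff in
lemma exists_integral_maternProfile_eq {lam : ℝ} (hlam : lam ≠ 0) (r : ℕ) {g : ℝ → ℝ}
    (hg : ContDiff ℝ ∞ g) (hgc : HasCompactSupport g) :
    ∃ h : ℝ → ℝ, ContDiff ℝ ∞ h ∧ HasCompactSupport h ∧
      ∀ t, ∫ s, maternProfile lam r (t - s) * h s = g t := by
  have key : ∀ {g : ℝ → ℝ}, ContDiff ℝ ∞ g → HasCompactSupport g → ∀ c : ℝ,
      ContDiff ℝ ∞ (fun s => c * (lam ^ 2 * g s - deriv (deriv g) s)) ∧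
      HasCompactSupport (fun s => c * (lam ^ 2 * g s - deriv (deriv g) s)) := by
    intro g hg hgc c
    have h2 : ContDiff ℝ ∞ (deriv (deriv g)) :=
      (contDiff_infty_iff_deriv.1 (contDiff_infty_iff_deriv.1 hg).2).2
    exact ⟨contDiff_const.mul ((contDiff_const.mul hg).sub h2),
      (hgc.mul_left.sub hgc.deriv.deriv).mul_left⟩
  induction r with
  | zero =>
    refine ⟨_, (key hg hgc (2 * lam)⁻¹).1, (key hg hgc _).2, fun t => ?_⟩
    simp_rw [mul_left_comm _ (2 * lam)⁻¹]
    rw [integral_const_mul, integral_maternProfile_zero lam (contDiff_infty.1 hg 2) hgc]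
    field_simp
  | succ r ih =>
    obtain ⟨h, hh, hc, he⟩ := ih
    refine ⟨_, (key hh hc (4 * (r + 1) * lam ^ 2)⁻¹).1, (key hh hc _).2, fun t => ?_⟩
    simp_rw [mul_left_comm _ (4 * ((r : ℝ) + 1) * lam ^ 2)⁻¹]
    rw [integral_const_mul, integral_maternProfile_succ lam r (contDiff_infty.1 hh 2) hc, he]
    have : (r : ℝ) + 1 ≠ 0 := by positivity
    field_simp

open scoped ContDiff in
/-- Smooth functions are dense in `C^m([a, b])`. -/
lemma exists_contDiff_infty_iteratedDeriv_near {m : ℕ} {f : ℝ → ℝ} (hf : ContDiff ℝ m f)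
    {a b : ℝ} (hab : a ≤ b) {ε : ℝ} (hε : 0 < ε) :
    ∃ g : ℝ → ℝ, ContDiff ℝ ∞ g ∧
      ∀ j ≤ m, ∀ t ∈ Set.Icc a b, |iteratedDeriv j f t - iteratedDeriv j g t| < ε := by
  induction m generalizing f ε with
  | zero =>
    obtain ⟨p, hp⟩ := exists_polynomial_near_of_continuousOn a b f hf.continuous.continuousOn ε hε
    refine ⟨fun x => p.eval x, by simpa using p.contDiff_aeval (𝕜 := ℝ) ∞, fun j hj t ht => ?_⟩
    obtain rfl : j = 0 := by omega
    simpa [abs_sub_comm] using hp t ht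
  | succ m ih =>
    push_cast at hf
    obtain ⟨hfd, -, hf'⟩ := contDiff_succ_iff_deriv.1 hf
    have hδ : 0 < ε / (b - a + 1) := div_pos hε (by linarith)
    obtain ⟨q, hq, hfq⟩ := ih hf' hδ
    have hδε : ε / (b - a + 1) ≤ ε := div_le_self hε.le (by linarith)
    have hg : ∀ x, HasDerivAt (fun x => f a + ∫ u in a..x, q u) (q x) x := fun x =>
      (hq.continuous.integral_hasStrictDerivAt a x).hasDerivAt.const_add _
    have hgq : deriv (fun x => f a + ∫ u in a..x, q u) = q := funext fun x => (hg x).deriv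
    refine ⟨fun x => f a + ∫ u in a..x, q u, ?_, fun j hj t ht => ?_⟩
    · rw [contDiff_infty_iff_deriv, hgq]
      exact ⟨fun x => (hg x).differentiableAt, hq⟩
    · rcases j with _ | j
      · have hd : ∀ x ∈ Set.Icc a b, HasDerivWithinAt (fun x => f x - (f a + ∫ u in a..x, q u))
            (deriv f x - q x) (Set.Icc a b) x := fun x _ =>
          ((hfd x).hasDerivAt.sub (hg x)).hasDerivWithinAt
        have := norm_image_sub_le_of_norm_deriv_le_segment' hd (C := ε / (b - a + 1))
          (fun x hx => by simpa using (hfq 0 (Nat.zero_le _) x (Set.Ico_subset_Icc_self hx)).le)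
          t ht
        simp only [Real.norm_eq_abs, intervalIntegral.integral_same, add_zero, sub_self,
          sub_zero] at this
        simp only [iteratedDeriv_zero]
        calc _ ≤ _ := this
          _ < ε / (b - a + 1) * (b - a + 1) := by
            have := ht.2
            gcongr
            linarith
          _ = ε := div_mul_cancel₀ _ (by linarith)
      · rw [iteratedDeriv_succ', iteratedDeriv_succ', hgq]
        exact (hfq j (by omega) t ht).trans_le hδε

open scoped ContDiff in
/-- Smooth compactly supported functions are dense in `C^m([a, b])`. -/
lemma exists_contDiff_infty_hasCompactSupport_iteratedDeriv_near {m : ℕ} {f : ℝ → ℝ}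
    (hf : ContDiff ℝ m f) {a b : ℝ} (hab : a ≤ b) {ε : ℝ} (hε : 0 < ε) :
    ∃ g : ℝ → ℝ, ContDiff ℝ ∞ g ∧ HasCompactSupport g ∧
      ∀ j ≤ m, ∀ t ∈ Set.Icc a b, |iteratedDeriv j f t - iteratedDeriv j g t| < ε := by
  obtain ⟨p, hp, hfp⟩ := exists_contDiff_infty_iteratedDeriv_near hf hab hε
  let χ : ContDiffBump ((a + b) / 2) :=
    { rIn := (b - a) / 2 + 1
      rOut := (b - a) / 2 + 2
      rIn_pos := by linarith
      rIn_lt_rOut := by linarith }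
  refine ⟨fun x => χ x * p x, χ.contDiff.mul hp, χ.hasCompactSupport.mul_right,
    fun j hj t ht => ?_⟩
  have ht' : t ∈ Metric.ball ((a + b) / 2) χ.rIn := by
    rw [Metric.mem_ball, Real.dist_eq, abs_lt]
    constructor <;> simp only [χ] <;> linarith [ht.1, ht.2]
  have he : (fun x => χ x * p x) =ᶠ[nhds t] p := by
    filter_upwards [χ.eventuallyEq_one_of_mem_ball ht'] with x hx
    simp [hx]
  rw [he.iteratedDeriv_eq]
  exact hfp j hj t ht

open MeasureTheory in
lemma Submodule.integral_mem_of_isClosed {α E : Type*} [MeasurableSpace α] {μ : Measure α}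
    [NormedAddCommGroup E] [NormedSpace ℝ E] [CompleteSpace E] {S : Submodule ℝ E}
    (hS : IsClosed (S : Set E)) {f : α → E} (hf : Integrable f μ) (hfS : ∀ s, f s ∈ S) :
    ∫ s, f s ∂μ ∈ S := by
  have hq : S.mkQL (∫ s, f s ∂μ) = 0 := by
    rw [← S.mkQL.integral_comp_comm hf]
    simp [(Submodule.Quotient.mk_eq_zero S).2 (hfS _)]
  exact (Submodule.Quotient.mk_eq_zero S).1 hq

open scoped ContDiff in
open MeasureTheory in
/-- If every smooth compactly supported function is a convolution of `K` with a smooth compactly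
supported function, then the translates of `K` span a dense subspace of `C^m([a, b])`. -/
lemma exists_sum_translates_near {m : ℕ} {K : ℝ → ℝ} (hK : ContDiff ℝ m K)
    (hconv : ∀ g : ℝ → ℝ, ContDiff ℝ ∞ g → HasCompactSupport g →
      ∃ h : ℝ → ℝ, ContDiff ℝ ∞ h ∧ HasCompactSupport h ∧ ∀ t, ∫ s, K (t - s) * h s = g t)
    {f : ℝ → ℝ} (hf : ContDiff ℝ m f) {a b : ℝ} (hab : a ≤ b) {ε : ℝ} (hε : 0 < ε) :
    ∃ (N : ℕ) (c : Fin N → ℝ) (s : Fin N → ℝ), ∀ j ≤ m, ∀ t ∈ Set.Icc a b,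
      |iteratedDeriv j f t - ∑ i, c i * iteratedDeriv j K (t - s i)| < ε := by
  obtain ⟨g, hg, hgc, hfg⟩ :=
    exists_contDiff_infty_hasCompactSupport_iteratedDeriv_near hf hab (half_pos hε)
  obtain ⟨h, hh, hhc, hKh⟩ := hconv g hg hgc
  have hKj : ∀ j : Fin (m + 1), Continuous (iteratedDeriv j K) := fun j =>
    hK.continuous_iteratedDeriv _ (by exact_mod_cast Nat.lt_succ_iff.1 j.2)
  let jet : ℝ → (Fin (m + 1) → C(Set.Icc a b, ℝ)) := fun s j =>
    ⟨fun t => iteratedDeriv j K (t - s),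
      (hKj j).comp (continuous_subtype_val.sub continuous_const)⟩
  have hjet : Continuous jet := by
    refine continuous_pi fun j => ContinuousMap.continuous_of_continuous_uncurry _ ?_
    exact (hKj j).comp ((continuous_subtype_val.comp continuous_snd).sub continuous_fst)
  let S := (Submodule.span ℝ (Set.range jet)).topologicalClosure
  have hS : IsClosed (S : Set (Fin (m + 1) → C(Set.Icc a b, ℝ))) :=
    Submodule.isClosed_topologicalClosure _
  have hw : Integrable fun s => h s • jet s :=
    (hh.continuous.smul hjet).integrable_of_hasCompactSupport hhc.smul_right
  have hval : ∀ (j : Fin (m + 1)) (t : Set.Icc a b),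
      (∫ s, h s • jet s) j t = iteratedDeriv j g t := by
    intro j t
    let L : (Fin (m + 1) → C(Set.Icc a b, ℝ)) →L[ℝ] ℝ := (ContinuousMap.evalCLM ℝ t).comp
      (ContinuousLinearMap.proj j)
    have hL : ∫ s, L (h s • jet s) = (∫ s, h s • jet s) j t := L.integral_comp_comm hw
    have hj : ContDiff ℝ (j : ℕ) K := hK.of_le (by exact_mod_cast Nat.lt_succ_iff.1 j.2)
    rw [← funext hKh, iteratedDeriv_integral_comp_const_sub_mul hj (contDiff_infty.1 hh 1) hhc]
    rw [← hL]
    refine integral_congr_ae (.of_forall fun s => ?_)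
    exact mul_comm _ _
  have hmem : ∫ s, h s • jet s ∈ S := Submodule.integral_mem_of_isClosed hS hw fun s =>
    S.smul_mem _ (Submodule.le_topologicalClosure _ (Submodule.subset_span ⟨s, rfl⟩))
  obtain ⟨v, hv, hdist⟩ := Metric.mem_closure_iff.1 hmem (ε / 2) (half_pos hε)
  obtain ⟨N, c, x, rfl⟩ := Submodule.mem_span_set'.1 hv
  choose s hs using fun i => (x i).2
  refine ⟨N, c, s, fun j hj t ht => ?_⟩
  have hle : |iteratedDeriv j g t - ∑ i, c i * iteratedDeriv j K (t - s i)| < ε / 2 := by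
    have h1 := (dist_le_pi_dist _ _ (⟨j, Nat.lt_succ_iff.2 hj⟩ : Fin (m + 1))).trans_lt hdist
    have h2 := (ContinuousMap.dist_apply_le_dist (⟨t, ht⟩ : Set.Icc a b)).trans_lt h1
    rw [hval, Real.dist_eq] at h2
    simpa [← hs, jet, Finset.sum_apply, ContinuousMap.sum_apply] using h2
  have := abs_sub_le (iteratedDeriv j f t) (iteratedDeriv j g t)
    (∑ i, c i * iteratedDeriv j K (t - s i))
  linarith [hfg j hj t ht]

lemma maternKernel_eq_maternProfile (r : ℕ) (σ ℓ t t' : ℝ) :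
    maternKernel r σ ℓ t t' = σ ^ 2 * ((r.factorial : ℝ) / ((2 * r).factorial : ℝ)) *
      maternProfile (Real.sqrt (2 * r + 1) / ℓ) r (t - t') := by
  have h : (besselPolynomial r).eval (2 * (Real.sqrt (2 * r + 1) / ℓ * |t - t'|)) =
      ∑ i ∈ Finset.range (r + 1),
      (((r + i).factorial : ℝ) / ((i.factorial : ℝ) * ((r - i).factorial : ℝ))) *
        (2 * Real.sqrt (2 * r + 1) * |t - t'| / ℓ) ^ (r - i) := by
    rw [besselPolynomial, Polynomial.eval_finsetSum, ← Finset.sum_range_reflect]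
    refine Finset.sum_congr rfl fun i hi => ?_
    have hi' : i ≤ r := Nat.lt_succ_iff.1 (Finset.mem_range.1 hi)
    have h1 : r + 1 - 1 - i = r - i := by omega
    have h2 : 2 * r - (r - i) = r + i := by omega
    have h3 : r - (r - i) = i := by omega
    rw [h1, h2, h3, Polynomial.eval_monomial]
    congr 2
    ring
  rw [maternKernel, maternProfile, h, show Real.sqrt (2 * r + 1) / ℓ * |t - t'| =
    Real.sqrt (2 * r + 1) * |t - t'| / ℓ by ring]
  ring

/-- Theorem 1 of the paper: the span of the Matérn kernel sections is dense in `C^m([a,b])`: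
for every `f` of class `C^m` and `ε > 0` there is a finite linear combination of kernel
sections approximating `f` together with its first `m` derivatives uniformly on `[a,b]`. -/
theorem maternKernel_span_dense_in_Cm (r m : ℕ) (hm : m ≤ r) (σ ℓ : ℝ)
    (hσ : 0 < σ) (hℓ : 0 < ℓ) (f : ℝ → ℝ) (hf : ContDiff ℝ m f)
    (a b : ℝ) (hab : a < b) (ε : ℝ) (hε : 0 < ε) :
    ∃ (N : ℕ) (c : Fin N → ℝ) (s : Fin N → ℝ),
      ∀ j ≤ m, ∀ t ∈ Set.Icc a b,
        |iteratedDeriv j f t -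
          ∑ i, c i * iteratedDeriv j (fun u => maternKernel r σ ℓ u (s i)) t| < ε := by
  set A : ℝ := σ ^ 2 * ((r.factorial : ℝ) / ((2 * r).factorial : ℝ))
  set lam : ℝ := Real.sqrt (2 * r + 1) / ℓ
  have hA : A ≠ 0 := by positivity
  have hlam : lam ≠ 0 := by positivity
  have hK : ContDiff ℝ m fun x => A * maternProfile lam r x :=
    contDiff_const.mul ((contDiff_maternProfile lam r).of_le (by exact_mod_cast hm))
  have hconv : ∀ g : ℝ → ℝ, ContDiff ℝ (⊤ : ℕ∞) g → HasCompactSupport g →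
      ∃ h : ℝ → ℝ, ContDiff ℝ (⊤ : ℕ∞) h ∧ HasCompactSupport h ∧
        ∀ t, ∫ s, A * maternProfile lam r (t - s) * h s = g t := fun g hg hgc => by
    obtain ⟨h, hh, hhc, he⟩ := exists_integral_maternProfile_eq hlam r hg hgc
    refine ⟨fun s => A⁻¹ * h s, contDiff_const.mul hh, hhc.mul_left, fun t => ?_⟩
    rw [← he t]
    congr 1
    ext s
    field_simp
  obtain ⟨N, c, s, h⟩ := exists_sum_translates_near hK hconv hf hab.le hε
  refine ⟨N, c, s, fun j hj t ht => ?_⟩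
  have hker : ∀ i, iteratedDeriv j (fun u => maternKernel r σ ℓ u (s i)) t =
      iteratedDeriv j (fun x => A * maternProfile lam r x) (t - s i) := fun i => by
    rw [funext fun u => maternKernel_eq_maternProfile r σ ℓ u (s i)]
    exact congrFun (iteratedDeriv_comp_sub_const j (fun x => A * maternProfile lam r x) (s i)) t
  simp_rw [hker]
  exact h j hj t ht
end

section
/- Let H be an n × q matrix over the polynomial ring ℝ[∂], let Q be an n × n matrix and V a q × q matrix over ℝ[∂] that are invertible over ℝ[∂] (i.e. there exist polynomial matrices Q', V' with Q·Q' = Q'·Q = I and V·V' = V'·V = I), and let D = Q·H·V. Letting matrices over ℝ[∂] act on tuples of smooth (C^∞) functions ℝ → ℝ as constant-coefficient differential operators, the map z ↦ V' • z is a bijection from the set of smooth solutions of H • z = 0 onto the set of smooth solutions of D • y = 0, with inverse y ↦ V • y; in particular, for every smooth q-tuple z, H • z = 0 if and only if D • (V' • z) = 0. (This is the structural fact that the Smith normal form decomposition Q·H·V = D preserves the solution space of the ODE system, on which the LODE-GP construction rests.) -/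
open Finset

/-- A polynomial `p ∈ ℝ[∂]` acts on a function `f` as the constant-coefficient differential
operator `p • f = Σ_k (coeff of ∂^k) · f^{(k)}`. -/
noncomputable def polyAct (p : Polynomial ℝ) (f : ℝ → ℝ) : ℝ → ℝ :=
  fun t => ∑ k ∈ Finset.range (p.natDegree + 1), p.coeff k * iteratedDeriv k f t

/-- A matrix over `ℝ[∂]` acts on a tuple of functions componentwise. -/
noncomputable def matAct {n q : ℕ} (M : Matrix (Fin n) (Fin q) (Polynomial ℝ))
    (z : Fin q → ℝ → ℝ) : Fin n → ℝ → ℝ :=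
  fun i t => ∑ j, polyAct (M i j) (z j) t

/-- The real vector space of smooth functions `ℝ → ℝ`. -/
def smoothFunctions : Submodule ℝ (ℝ → ℝ) where
  carrier := {f | ContDiff ℝ (⊤ : ℕ∞) f}
  add_mem' hf hg := Set.mem_ofPred.2 ((Set.mem_ofPred.1 hf).add (Set.mem_ofPred.1 hg))
  zero_mem' := Set.mem_ofPred.2 contDiff_zero_fun
  smul_mem' c _ hf := Set.mem_ofPred.2 ((Set.mem_ofPred.1 hf).const_smul c)

lemma mem_smoothFunctions {f : ℝ → ℝ} : f ∈ smoothFunctions ↔ ContDiff ℝ (⊤ : ℕ∞) f :=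
  Set.mem_ofPred

lemma differentiable_of_smoothFunctions (f : smoothFunctions) : Differentiable ℝ (f : ℝ → ℝ) :=
  (contDiff_infty_iff_deriv.1 (mem_smoothFunctions.1 f.2)).1

/-- Differentiation as an endomorphism of the space of smooth functions. -/
noncomputable def smoothDeriv : Module.End ℝ smoothFunctions where
  toFun f := ⟨deriv f, mem_smoothFunctions.2
    (contDiff_infty_iff_deriv.1 (mem_smoothFunctions.1 f.2)).2⟩
  map_add' f g := Subtype.ext <| funext fun t =>
    deriv_add (differentiable_of_smoothFunctions f t) (differentiable_of_smoothFunctions g t)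
  map_smul' c f := Subtype.ext <| funext fun t =>
    deriv_const_smul c (differentiable_of_smoothFunctions f t)

lemma coe_smoothDeriv_pow (k : ℕ) (f : smoothFunctions) :
    ((smoothDeriv ^ k) f : ℝ → ℝ) = iteratedDeriv k f := by
  induction k with
  | zero => simp
  | succ k ih => rw [pow_succ', iteratedDeriv_succ, ← ih]; rfl

lemma polyAct_coe (p : Polynomial ℝ) (f : smoothFunctions) :
    polyAct p f = (Polynomial.aeval smoothDeriv p f : smoothFunctions) := by
  funext t
  simp [polyAct, Polynomial.aeval_eq_sum_range, coe_smoothDeriv_pow, Finset.sum_apply]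

lemma matAct_coe {n q : ℕ} (M : Matrix (Fin n) (Fin q) (Polynomial ℝ))
    (z : Fin q → smoothFunctions) (i : Fin n) :
    matAct M (fun j => (z j : ℝ → ℝ)) i =
      (∑ j, Polynomial.aeval smoothDeriv (M i j) (z j) : smoothFunctions) := by
  funext t
  simp [matAct, polyAct_coe, Finset.sum_apply]

lemma contDiff_matAct {n q : ℕ} (M : Matrix (Fin n) (Fin q) (Polynomial ℝ))
    {z : Fin q → ℝ → ℝ} (hz : ∀ i, ContDiff ℝ (⊤ : ℕ∞) (z i)) (i : Fin n) :
    ContDiff ℝ (⊤ : ℕ∞) (matAct M z i) := by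
  rw [matAct_coe M fun j => ⟨z j, mem_smoothFunctions.2 (hz j)⟩]
  exact mem_smoothFunctions.1 (Subtype.property _)

lemma matAct_mul {m n q : ℕ} (M : Matrix (Fin m) (Fin n) (Polynomial ℝ))
    (N : Matrix (Fin n) (Fin q) (Polynomial ℝ))
    {z : Fin q → ℝ → ℝ} (hz : ∀ i, ContDiff ℝ (⊤ : ℕ∞) (z i)) :
    matAct (M * N) z = matAct M (matAct N z) := by
  lift z to Fin q → smoothFunctions using fun i => mem_smoothFunctions.2 (hz i)
  ext1 i
  rw [matAct_coe, funext (matAct_coe N z), matAct_coe]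
  simp only [Matrix.mul_apply, map_sum, map_mul, LinearMap.sum_apply, Module.End.mul_apply]
  rw [Finset.sum_comm]

lemma matAct_one {q : ℕ} (z : Fin q → ℝ → ℝ) : matAct 1 z = z := by
  funext i t
  have h (j : Fin q) :
      polyAct ((1 : Matrix (Fin q) (Fin q) (Polynomial ℝ)) i j) (z j) t =
        if i = j then z j t else 0 := by
    by_cases hij : i = j <;> simp [polyAct, Matrix.one_apply, hij]
  simp [matAct, h]

lemma matAct_zero {n q : ℕ} (M : Matrix (Fin n) (Fin q) (Polynomial ℝ)) : matAct M 0 = 0 := by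
  ext1 i
  exact (matAct_coe M 0 i).trans (by simp)

/-- The Smith normal form decomposition `D = Q·H·V` (with `Q`, `V` invertible over `ℝ[∂]`)
preserves the smooth solution space: `z ↦ V' • z` is a bijection from the smooth solutions
of `H • z = 0` onto the smooth solutions of `D • y = 0` with inverse `y ↦ V • y`; in
particular `H • z = 0 ↔ D • (V' • z) = 0` for every smooth `z`. -/
theorem smith_normal_form_preserves_solutions (n q : ℕ)
    (H : Matrix (Fin n) (Fin q) (Polynomial ℝ))
    (Q Q' : Matrix (Fin n) (Fin n) (Polynomial ℝ))
    (V V' : Matrix (Fin q) (Fin q) (Polynomial ℝ))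
    (hQ : Q * Q' = 1) (hQ' : Q' * Q = 1) (hV : V * V' = 1) (hV' : V' * V = 1)
    (D : Matrix (Fin n) (Fin q) (Polynomial ℝ)) (hD : D = Q * H * V) :
    (∀ z : Fin q → ℝ → ℝ, (∀ i, ContDiff ℝ (⊤ : ℕ∞) (z i)) → matAct H z = 0 →
      (∀ i, ContDiff ℝ (⊤ : ℕ∞) (matAct V' z i)) ∧ matAct D (matAct V' z) = 0) ∧
    (∀ y : Fin q → ℝ → ℝ, (∀ i, ContDiff ℝ (⊤ : ℕ∞) (y i)) → matAct D y = 0 →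
      (∀ i, ContDiff ℝ (⊤ : ℕ∞) (matAct V y i)) ∧ matAct H (matAct V y) = 0) ∧
    (∀ z : Fin q → ℝ → ℝ, (∀ i, ContDiff ℝ (⊤ : ℕ∞) (z i)) → matAct H z = 0 →
      matAct V (matAct V' z) = z) ∧
    (∀ y : Fin q → ℝ → ℝ, (∀ i, ContDiff ℝ (⊤ : ℕ∞) (y i)) → matAct D y = 0 →
      matAct V' (matAct V y) = y) ∧
    (∀ z : Fin q → ℝ → ℝ, (∀ i, ContDiff ℝ (⊤ : ℕ∞) (z i)) →
      (matAct H z = 0 ↔ matAct D (matAct V' z) = 0)) := by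
  have hVV' {z : Fin q → ℝ → ℝ} (hz : ∀ i, ContDiff ℝ (⊤ : ℕ∞) (z i)) :
      matAct V (matAct V' z) = z := by
    rw [← matAct_mul V V' hz, hV, matAct_one]
  have hV'V {y : Fin q → ℝ → ℝ} (hy : ∀ i, ContDiff ℝ (⊤ : ℕ∞) (y i)) :
      matAct V' (matAct V y) = y := by
    rw [← matAct_mul V' V hy, hV', matAct_one]
  have hDQ {y : Fin q → ℝ → ℝ} (hy : ∀ i, ContDiff ℝ (⊤ : ℕ∞) (y i)) :
      matAct D y = matAct Q (matAct H (matAct V y)) := by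
    rw [hD, matAct_mul _ V hy, matAct_mul Q H (contDiff_matAct V hy)]
  have hiff {y : Fin q → ℝ → ℝ} (hy : ∀ i, ContDiff ℝ (⊤ : ℕ∞) (y i)) :
      matAct H (matAct V y) = 0 ↔ matAct D y = 0 := by
    refine ⟨fun h => by rw [hDQ hy, h, matAct_zero], fun h => ?_⟩
    rw [← matAct_one (matAct H (matAct V y)), ← hQ',
      matAct_mul Q' Q (contDiff_matAct H (contDiff_matAct V hy)), ← hDQ hy, h, matAct_zero]
  have hiff' {z : Fin q → ℝ → ℝ} (hz : ∀ i, ContDiff ℝ (⊤ : ℕ∞) (z i)) :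
      matAct H z = 0 ↔ matAct D (matAct V' z) = 0 := by
    rw [← hiff (contDiff_matAct V' hz), hVV' hz]
  exact ⟨fun z hz h => ⟨contDiff_matAct V' hz, (hiff' hz).1 h⟩,
    fun y hy h => ⟨contDiff_matAct V hy, (hiff hy).2 h⟩,
    fun z hz _ => hVV' hz, fun y hy _ => hV'V hy, fun z hz => hiff' hz⟩
end

section
/- For fixed σ > 0, ℓ > 0 and fixed t, t' ∈ ℝ, the half-integer Matérn kernels converge pointwise to the squared-exponential kernel as the smoothness parameter tends to infinity: lim_{r → ∞} k_{r+1/2}(t, t') = σ² · exp(−(t−t')²/(2ℓ²)). (This is the paper's claim that the SE kernel is obtained as a Matérn kernel for ν → ∞.) -/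
open Real Finset Filter

/-- The reverse Bessel polynomials normalised to have constant term `1`. -/
noncomputable def normalizedBessel : ℕ → ℝ → ℝ
  | 0, _ => 1
  | 1, x => 1 + x
  | r + 2, x => normalizedBessel (r + 1) x +
      x ^ 2 / ((2 * r + 3) * (2 * r + 1)) * normalizedBessel r x

/-- The coefficients of the normalised reverse Bessel polynomials. -/
noncomputable def besselCoeff (r j : ℕ) : ℝ :=
  if j ≤ r then (r.factorial : ℝ) / ((2 * r).factorial : ℝ) *
    (((2 * r - j).factorial : ℝ) / (((r - j).factorial : ℝ) * (j.factorial : ℝ))) * 2 ^ j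
  else 0

lemma besselCoeff_zero_right (r : ℕ) : besselCoeff r 0 = 1 := by
  have h1 : (r.factorial : ℝ) ≠ 0 := by positivity
  have h2 : ((2 * r).factorial : ℝ) ≠ 0 := by positivity
  simp [besselCoeff]
  field_simp

lemma besselCoeff_succ_one (r : ℕ) : besselCoeff (r + 1) 1 = 1 := by
  have h1 : (r.factorial : ℝ) ≠ 0 := by positivity
  have h2 : ((2 * r + 1).factorial : ℝ) ≠ 0 := by positivity
  rw [besselCoeff, if_pos (by omega), show 2 * (r + 1) = (2 * r + 1) + 1 by ring,
    Nat.add_sub_cancel, Nat.add_sub_cancel, Nat.factorial_succ (2 * r + 1), Nat.factorial_succ r]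
  push_cast
  field_simp
  ring

lemma besselCoeff_add_two (r j : ℕ) (hj : j ≤ r) :
    besselCoeff (r + 2) (j + 2) =
      besselCoeff (r + 1) (j + 2) + 1 / ((2 * r + 3) * (2 * r + 1)) * besselCoeff r j := by
  obtain ⟨k, rfl⟩ := Nat.exists_eq_add_of_le hj
  have e4 : 2 * (j + k + 2) = 2 * (j + k) + 4 := by ring
  have e2 : 2 * (j + k + 1) = 2 * (j + k) + 2 := by ring
  have h1 : ((j + k).factorial : ℝ) ≠ 0 := by positivity
  have h2 : ((2 * (j + k)).factorial : ℝ) ≠ 0 := by positivity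
  have h3 : (j.factorial : ℝ) ≠ 0 := by positivity
  rcases k with _ | k
  · rw [besselCoeff, besselCoeff, besselCoeff, if_pos (by omega), if_neg (by omega),
      if_pos (by omega), e4,
      show 2 * (j + 0) + 4 - (j + 2) = j + 2 by omega,
      show j + 0 + 2 - (j + 2) = 0 by omega,
      show 2 * (j + 0) - j = j by omega, show j + 0 - j = 0 by omega]
    simp only [Nat.factorial_succ, add_zero] at h2 ⊢
    push_cast
    field_simp
    ring
  · have h4 : ((j + 2 * k + 1).factorial : ℝ) ≠ 0 := by positivity
    have h5 : (k.factorial : ℝ) ≠ 0 := by positivity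
    rw [besselCoeff, besselCoeff, besselCoeff, if_pos (by omega), if_pos (by omega),
      if_pos (by omega), e4, e2,
      show 2 * (j + (k + 1)) + 4 - (j + 2) = (j + 2 * k + 2) + 2 by omega,
      show j + (k + 1) + 2 - (j + 2) = k + 1 by omega,
      show 2 * (j + (k + 1)) + 2 - (j + 2) = j + 2 * k + 2 by omega,
      show j + (k + 1) + 1 - (j + 2) = k by omega,
      show 2 * (j + (k + 1)) - j = j + 2 * k + 2 by omega,
      show j + (k + 1) - j = k + 1 by omega]
    have e : ∀ n : ℕ, ((n + 1).factorial : ℝ) = ((n : ℝ) + 1) * n.factorial := fun n => by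
      rw [Nat.factorial_succ]; push_cast; ring
    generalize hA : j + (k + 1) = m at *
    have hm : (m : ℝ) = j + (k + 1) := by rw [← hA]; push_cast; ring
    simp only [e]
    push_cast
    have hk : (k : ℝ) + 1 ≠ 0 := by positivity
    have hd : (2 * (m : ℝ) + 1) ≠ 0 := by positivity
    have hd3 : (2 * (m : ℝ) + 3) ≠ 0 := by positivity
    field_simp
    rw [hm]
    ring

lemma normalizedBessel_eq_sum (r : ℕ) (x : ℝ) :
    normalizedBessel r x = ∑ j ∈ Finset.range (r + 1), besselCoeff r j * x ^ j := by
  induction r using Nat.twoStepInduction with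
  | zero => simp [normalizedBessel, besselCoeff_zero_right]
  | one =>
    simp [normalizedBessel, besselCoeff_zero_right, Finset.sum_range_succ,
      besselCoeff_succ_one 0]
  | more r ih0 ih1 =>
    have h : normalizedBessel (r + 1) x =
        ∑ j ∈ Finset.range (r + 1 + 1 + 1), besselCoeff (r + 1) j * x ^ j := by
      rw [Finset.sum_range_succ, ← ih1]
      simp [besselCoeff]
    rw [normalizedBessel, h, ih0]
    rw [Finset.sum_range_succ' _ (r + 1 + 1), Finset.sum_range_succ' _ (r + 1),
      Finset.sum_range_succ' _ (r + 2), Finset.sum_range_succ' _ (r + 1)]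
    simp only [zero_add, besselCoeff_zero_right, besselCoeff_succ_one]
    have hs : ∑ j ∈ Finset.range (r + 1), besselCoeff (r + 2) (j + 1 + 1) * x ^ (j + 1 + 1) =
        ∑ j ∈ Finset.range (r + 1), besselCoeff (r + 1) (j + 1 + 1) * x ^ (j + 1 + 1) +
        x ^ 2 / ((2 * r + 3) * (2 * r + 1)) *
          ∑ j ∈ Finset.range (r + 1), besselCoeff r j * x ^ j := by
      rw [Finset.mul_sum, ← Finset.sum_add_distrib]
      refine Finset.sum_congr rfl fun j hj => ?_
      rw [besselCoeff_add_two r j (by have := Finset.mem_range.mp hj; omega)]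
      ring
    rw [hs]
    ring

lemma maternKernel_eq_normalizedBessel (r : ℕ) (σ ℓ t t' : ℝ) :
    maternKernel r σ ℓ t t' =
      σ ^ 2 * (Real.exp (-(Real.sqrt (2 * r + 1) * (|t - t'| / ℓ))) *
        normalizedBessel r (Real.sqrt (2 * r + 1) * (|t - t'| / ℓ))) := by
  rw [maternKernel, normalizedBessel_eq_sum, ← Finset.sum_range_reflect, mul_assoc, mul_assoc,
    mul_div_assoc, Finset.mul_sum]
  congr 2
  refine Finset.sum_congr rfl fun i hi => ?_
  have hi' : i ≤ r := by have := Finset.mem_range.mp hi; omega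
  rw [show r + 1 - 1 - i = r - i by omega, besselCoeff, if_pos hi',
    show r - (r - i) = i by omega, show r + (r - i) = 2 * r - i by omega,
    mul_div_assoc, mul_assoc 2, mul_pow 2]
  ring

lemma normalizedBessel_pos (r : ℕ) {x : ℝ} (hx : 0 ≤ x) : 0 < normalizedBessel r x := by
  induction r using Nat.twoStepInduction with
  | zero => simp [normalizedBessel]
  | one => simp only [normalizedBessel]; positivity
  | more r ih0 ih1 => simp only [normalizedBessel]; positivity

lemma normalizedBessel_le_succ (r : ℕ) {x : ℝ} (hx : 0 ≤ x) :
    normalizedBessel r x ≤ normalizedBessel (r + 1) x := by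
  cases r with
  | zero => simpa [normalizedBessel] using hx
  | succ r =>
    have := normalizedBessel_pos r hx
    simp only [normalizedBessel]
    exact le_add_of_nonneg_right (by positivity)

lemma normalizedBessel_zero_right (r : ℕ) : normalizedBessel r 0 = 1 := by
  induction r using Nat.twoStepInduction with
  | zero => simp [normalizedBessel]
  | one => simp [normalizedBessel]
  | more r ih0 ih1 => simp [normalizedBessel, ih1]

lemma hasDerivAt_normalizedBessel (r : ℕ) (x : ℝ) :
    HasDerivAt (normalizedBessel (r + 1))
      (normalizedBessel (r + 1) x - x / (2 * r + 1) * normalizedBessel r x) x := by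
  have h0 : HasDerivAt (normalizedBessel 0) 0 x := hasDerivAt_const x (1 : ℝ)
  have h1 : HasDerivAt (normalizedBessel 1) 1 x := (hasDerivAt_id x).const_add 1
  have step : ∀ (r : ℕ) {a b : ℝ}, HasDerivAt (normalizedBessel r) a x →
      HasDerivAt (normalizedBessel (r + 1)) b x →
      HasDerivAt (normalizedBessel (r + 2))
        (b + (2 * x / ((2 * r + 3) * (2 * r + 1)) * normalizedBessel r x +
          x ^ 2 / ((2 * r + 3) * (2 * r + 1)) * a)) x := fun r a b ha hb => by
    have hp : HasDerivAt (fun y : ℝ => y ^ 2 / ((2 * (r : ℝ) + 3) * (2 * r + 1)))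
        (2 * x / ((2 * r + 3) * (2 * r + 1))) x := by
      simpa using (hasDerivAt_pow 2 x).div_const ((2 * (r : ℝ) + 3) * (2 * r + 1))
    exact hb.add (hp.mul ha)
  induction r using Nat.twoStepInduction with
  | zero =>
    convert h1 using 1
    simp [normalizedBessel]
  | one =>
    convert step 0 h0 h1 using 1
    simp [normalizedBessel]
    ring
  | more r ih0 ih1 =>
    convert step (r + 1) ih0 ih1 using 1
    simp only [normalizedBessel]
    push_cast
    have a1 : (2 * (r : ℝ) + 1) ≠ 0 := by positivity
    have a2 : (2 * (r : ℝ) + 3) ≠ 0 := by positivity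
    have a3 : (2 * ((r : ℝ) + 1) + 1) ≠ 0 := by positivity
    have a4 : (2 * ((r : ℝ) + 1) + 3) ≠ 0 := by positivity
    have a5 : (2 * ((r : ℝ) + 2) + 1) ≠ 0 := by positivity
    field_simp
    ring

lemma hasDerivAt_exp_neg_mul_normalizedBessel (r : ℕ) (x : ℝ) :
    HasDerivAt (fun y => Real.exp (-y) * normalizedBessel (r + 1) y)
      (-(x * (Real.exp (-x) * normalizedBessel r x / (2 * r + 1)))) x := by
  have := (hasDerivAt_neg x).exp.mul (hasDerivAt_normalizedBessel r x)
  refine this.congr_deriv ?_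
  ring

/-- A Grönwall type lower bound for solutions of `f' = -x g` with `g ≤ b f`. -/
lemma exp_neg_sq_le_of_hasDerivAt {f g : ℝ → ℝ} {b X : ℝ} (hX : 0 ≤ X)
    (hf : ∀ x, HasDerivAt f (-(x * g x)) x) (h0 : f 0 = 1)
    (hg : ∀ x ∈ Set.Icc 0 X, g x ≤ b * f x) : Real.exp (-(b * X ^ 2 / 2)) ≤ f X := by
  have hF : ∀ x, HasDerivAt (fun y => f y * Real.exp (b * y ^ 2 / 2))
      (Real.exp (b * x ^ 2 / 2) * (x * (b * f x - g x))) x := fun x => by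
    have hq : HasDerivAt (fun y : ℝ => b * y ^ 2 / 2) (b * x) x := by
      refine (((hasDerivAt_pow 2 x).const_mul b).div_const 2).congr_deriv ?_
      simp
      ring
    refine ((hf x).mul hq.exp).congr_deriv ?_
    ring
  have hmono : MonotoneOn (fun y => f y * Real.exp (b * y ^ 2 / 2)) (Set.Icc 0 X) := by
    refine monotoneOn_of_deriv_nonneg (convex_Icc 0 X)
      (fun x _ => (hF x).continuousAt.continuousWithinAt)
      (fun x _ => (hF x).differentiableAt.differentiableWithinAt) fun x hx => ?_
    have hx' := interior_subset hx
    rw [(hF x).deriv]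
    exact mul_nonneg (Real.exp_pos _).le (mul_nonneg hx'.1 (sub_nonneg.mpr (hg x hx')))
  have h := hmono (Set.left_mem_Icc.mpr hX) (Set.right_mem_Icc.mpr hX) hX
  simp only [h0] at h
  rw [Real.exp_neg, inv_le_iff_one_le_mul₀ (Real.exp_pos _)]
  simpa using h

/-- A Grönwall type upper bound for solutions of `f' = -x g` with `a f ≤ g`. -/
lemma le_exp_neg_sq_of_hasDerivAt {f g : ℝ → ℝ} {a X : ℝ} (hX : 0 ≤ X)
    (hf : ∀ x, HasDerivAt f (-(x * g x)) x) (h0 : f 0 = 1)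
    (hg : ∀ x ∈ Set.Icc 0 X, a * f x ≤ g x) : f X ≤ Real.exp (-(a * X ^ 2 / 2)) := by
  have hF : ∀ x, HasDerivAt (fun y => f y * Real.exp (a * y ^ 2 / 2))
      (Real.exp (a * x ^ 2 / 2) * (x * (a * f x - g x))) x := fun x => by
    have hq : HasDerivAt (fun y : ℝ => a * y ^ 2 / 2) (a * x) x := by
      refine (((hasDerivAt_pow 2 x).const_mul a).div_const 2).congr_deriv ?_
      simp
      ring
    refine ((hf x).mul hq.exp).congr_deriv ?_
    ring
  have hanti : AntitoneOn (fun y => f y * Real.exp (a * y ^ 2 / 2)) (Set.Icc 0 X) := by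
    refine antitoneOn_of_deriv_nonpos (convex_Icc 0 X)
      (fun x _ => (hF x).continuousAt.continuousWithinAt)
      (fun x _ => (hF x).differentiableAt.differentiableWithinAt) fun x hx => ?_
    have hx' := interior_subset hx
    rw [(hF x).deriv]
    exact mul_nonpos_of_nonneg_of_nonpos (Real.exp_pos _).le
      (mul_nonpos_of_nonneg_of_nonpos hx'.1 (sub_nonpos.mpr (hg x hx')))
  have h := hanti (Set.left_mem_Icc.mpr hX) (Set.right_mem_Icc.mpr hX) hX
  simp only [h0] at h
  rw [Real.exp_neg, ← one_div, le_div_iff₀ (Real.exp_pos _)]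
  simpa using h

lemma exp_neg_sq_le_normalizedBessel (n : ℕ) {X : ℝ} (hX : 0 ≤ X) :
    Real.exp (-(1 / (2 * n + 1) * X ^ 2 / 2)) ≤ Real.exp (-X) * normalizedBessel (n + 1) X := by
  refine exp_neg_sq_le_of_hasDerivAt hX (hasDerivAt_exp_neg_mul_normalizedBessel n)
    (by simp [normalizedBessel_zero_right]) fun x hx => ?_
  rw [div_eq_inv_mul, one_div]
  gcongr
  exact normalizedBessel_le_succ n hx.1

lemma normalizedBessel_le_exp_neg_sq (n : ℕ) {X : ℝ} (hX : 0 ≤ X) :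
    Real.exp (-X) * normalizedBessel (n + 2) X ≤
      Real.exp (-(1 / ((2 * n + 3) * (1 + X ^ 2 / ((2 * n + 3) * (2 * n + 1)))) * X ^ 2 / 2)) := by
  refine le_exp_neg_sq_of_hasDerivAt hX (hasDerivAt_exp_neg_mul_normalizedBessel (n + 1))
    (by simp [normalizedBessel_zero_right]) fun x hx => ?_
  have h1 := normalizedBessel_pos n hx.1
  have h2 := normalizedBessel_pos (n + 1) hx.1
  have key : normalizedBessel (n + 2) x ≤
      (1 + X ^ 2 / ((2 * n + 3) * (2 * n + 1))) * normalizedBessel (n + 1) x := by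
    simp only [normalizedBessel]
    rw [add_mul (1 : ℝ) _ _, one_mul]
    have := hx.1
    have := hx.2
    gcongr
    exact normalizedBessel_le_succ n hx.1
  have e : (2 * ((n + 1 : ℕ) : ℝ) + 1) = 2 * n + 3 := by push_cast; ring
  rw [e, one_div_mul_eq_div, div_le_div_iff₀ (by positivity) (by positivity)]
  calc Real.exp (-x) * normalizedBessel (n + 2) x * (2 * n + 3)
      ≤ Real.exp (-x) * ((1 + X ^ 2 / ((2 * n + 3) * (2 * n + 1))) *
          normalizedBessel (n + 1) x) * (2 * n + 3) := by gcongr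
    _ = _ := by ring

lemma tendsto_exp_neg_mul_normalizedBessel {d : ℝ} (hd : 0 ≤ d) :
    Tendsto (fun r : ℕ => Real.exp (-(Real.sqrt (2 * r + 1) * d)) *
      normalizedBessel r (Real.sqrt (2 * r + 1) * d)) atTop (nhds (Real.exp (-(d ^ 2 / 2)))) := by
  rw [← tendsto_add_atTop_iff_nat 2]
  have hn : Tendsto (fun n : ℕ => 2 * (n : ℝ)) atTop atTop :=
    tendsto_natCast_atTop_atTop.const_mul_atTop two_pos
  have hinv : ∀ c : ℝ, Tendsto (fun n : ℕ => (2 * (n : ℝ) + c)⁻¹) atTop (nhds 0) := fun c =>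
    tendsto_inv_atTop_zero.comp (tendsto_atTop_add_const_right _ c hn)
  have hX : ∀ n : ℕ, (Real.sqrt (2 * ((n + 2 : ℕ) : ℝ) + 1) * d) ^ 2 = (2 * n + 5) * d ^ 2 :=
    fun n => by
      rw [mul_pow, Real.sq_sqrt (by positivity)]
      push_cast
      ring
  have hratio : Tendsto (fun n : ℕ => (1 + 2 * (2 * (n : ℝ) + 3)⁻¹) * d ^ 2) atTop
      (nhds (d ^ 2)) := by
    simpa using (((hinv 3).const_mul 2).const_add 1).mul_const (d ^ 2)
  have hden : Tendsto (fun n : ℕ => 1 + (1 + 2 * (2 * (n : ℝ) + 3)⁻¹) * d ^ 2 *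
      (2 * (n : ℝ) + 1)⁻¹) atTop (nhds 1) := by
    simpa using (hratio.mul (hinv 1)).const_add 1
  have hquot : Tendsto (fun n : ℕ => (1 + 2 * (2 * (n : ℝ) + 3)⁻¹) * d ^ 2 /
      (1 + (1 + 2 * (2 * (n : ℝ) + 3)⁻¹) * d ^ 2 * (2 * (n : ℝ) + 1)⁻¹)) atTop
      (nhds (d ^ 2)) := by
    simpa only [div_one] using! hratio.div hden one_ne_zero
  refine tendsto_of_tendsto_of_tendsto_of_le_of_le
    ((Real.continuous_exp.tendsto _).comp (hratio.div_const 2).neg)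
    ((Real.continuous_exp.tendsto _).comp (hquot.div_const 2).neg) (fun n => ?_) (fun n => ?_)
  · refine le_trans (le_of_eq ?_) (exp_neg_sq_le_normalizedBessel (n + 1) (by positivity))
    rw [hX]
    simp only [Function.comp]
    congr 3
    push_cast
    field_simp
    ring
  · refine le_trans (normalizedBessel_le_exp_neg_sq n (by positivity)) (le_of_eq ?_)
    rw [hX]
    simp only [Function.comp]
    congr 3
    have e : (1 + 2 * (2 * (n : ℝ) + 3)⁻¹) = (2 * n + 5) / (2 * n + 3) := by
      field_simp
      ring
    rw [e, one_div_mul_eq_div, div_mul_eq_mul_div, ← div_eq_mul_inv, div_div, div_div]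

/-- The squared-exponential kernel is obtained as the limit of the half-integer Matérn
kernels as the smoothness parameter `ν = r + 1/2` tends to infinity:
`k_{r+1/2}(t,t') → σ² exp(−(t−t')²/(2ℓ²))`. -/
theorem maternKernel_tendsto_SE (σ ℓ t t' : ℝ) (hσ : 0 < σ) (hℓ : 0 < ℓ) :
    Tendsto (fun r : ℕ => maternKernel r σ ℓ t t') atTop
      (nhds (σ ^ 2 * Real.exp (-(t - t') ^ 2 / (2 * ℓ ^ 2)))) := by
  have h := (tendsto_exp_neg_mul_normalizedBessel
    (div_nonneg (abs_nonneg (t - t')) hℓ.le)).const_mul (σ ^ 2)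
  have e : -(t - t') ^ 2 / (2 * ℓ ^ 2) = -((|t - t'| / ℓ) ^ 2 / 2) := by
    rw [div_pow, sq_abs]
    field_simp
  rw [e]
  exact h.congr fun r => (maternKernel_eq_normalizedBessel r σ ℓ t t').symm
end

section
/- For every r ∈ ℕ and every σ > 0, ℓ > 0, the half-integer Matérn kernel k_{r+1/2} is a positive semidefinite kernel on ℝ: for every n ∈ ℕ, all points t₁, …, t_n ∈ ℝ and all coefficients c₁, …, c_n ∈ ℝ, Σ_{i=1}^n Σ_{j=1}^n c_i c_j k_{r+1/2}(t_i, t_j) ≥ 0. (This is the property that makes k_{r+1/2} a valid Gaussian process covariance function, which the paper's use of Matérn kernels as latent covariances in the LODE-GP relies on.) -/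
open Real Finset

open MeasureTheory

theorem integral_pow_mul_exp_neg_two_mul (m : ℕ) :
    ∫ u in Set.Ioi (0 : ℝ), u ^ m * exp (-(2 * u)) = m.factorial / 2 ^ (m + 1) := by
  have h := Real.integral_rpow_mul_exp_neg_mul_Ioi (a := (m : ℝ) + 1) (r := 2)
    (by positivity) two_pos
  simp only [add_sub_cancel_right, Real.rpow_natCast, Real.Gamma_nat_eq_factorial] at h
  rw [h, ← Nat.cast_succ, Real.rpow_natCast, one_div, inv_pow]
  field_simp

theorem integrableOn_pow_mul_exp_neg_two_mul (m : ℕ) :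
    IntegrableOn (fun u : ℝ => u ^ m * exp (-(2 * u))) (Set.Ioi 0) := by
  by_contra h
  have h0 := integral_undef h
  rw [integral_pow_mul_exp_neg_two_mul] at h0
  exact absurd h0 (by positivity)

/-- The function `u ↦ u ^ r * exp (-u)` on the positive half-line, extended by zero: the moving
average filter of the half-integer Matérn kernel. -/
noncomputable def maternFilter (r : ℕ) : ℝ → ℝ :=
  (Set.Ioi 0).indicator fun u => u ^ r * exp (-u)

theorem maternFilter_mul_maternFilter_add (r : ℕ) {d : ℝ} (hd : 0 ≤ d) :
    (fun u => maternFilter r u * maternFilter r (u + d)) =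
      (Set.Ioi 0).indicator fun u => ∑ i ∈ range (r + 1),
        exp (-d) * r.choose i * d ^ (r - i) * (u ^ (r + i) * exp (-(2 * u))) := by
  ext u
  by_cases hu : 0 < u
  · have hud : 0 < u + d := by positivity
    have he : exp (-u) * exp (-(u + d)) = exp (-d) * exp (-(2 * u)) := by
      rw [← Real.exp_add, ← Real.exp_add]
      ring_nf
    simp only [maternFilter, Set.indicator_of_mem, Set.mem_Ioi, hu, hud]
    calc u ^ r * exp (-u) * ((u + d) ^ r * exp (-(u + d)))
        = u ^ r * (u + d) ^ r * (exp (-u) * exp (-(u + d))) := by ring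
      _ = _ := by
        rw [he, add_pow, mul_sum, sum_mul]
        refine sum_congr rfl fun i _ => ?_
        rw [pow_add]
        ring
  · simp [maternFilter, hu]

theorem integrable_maternFilter_mul_add (r : ℕ) {d : ℝ} (hd : 0 ≤ d) :
    Integrable fun u => maternFilter r u * maternFilter r (u + d) := by
  rw [maternFilter_mul_maternFilter_add r hd, integrable_indicator_iff measurableSet_Ioi]
  exact integrable_finsetSum _ fun i _ =>
    (integrableOn_pow_mul_exp_neg_two_mul (r + i)).const_mul _

theorem integral_maternFilter_mul_add (r : ℕ) {d : ℝ} (hd : 0 ≤ d) :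
    ∫ u, maternFilter r u * maternFilter r (u + d) =
      ∑ i ∈ range (r + 1),
        exp (-d) * r.choose i * d ^ (r - i) * ((r + i).factorial / 2 ^ (r + i + 1)) := by
  rw [maternFilter_mul_maternFilter_add r hd, integral_indicator measurableSet_Ioi,
    integral_finsetSum _ fun i _ =>
      (integrableOn_pow_mul_exp_neg_two_mul (r + i)).const_mul _]
  refine sum_congr rfl fun i _ => ?_
  rw [integral_const_mul, integral_pow_mul_exp_neg_two_mul]

theorem integrable_maternFilter_sub_mul_sub (r : ℕ) (a b : ℝ) :
    Integrable fun u => maternFilter r (u - a) * maternFilter r (u - b) := by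
  wlog h : b ≤ a generalizing a b
  · simpa only [mul_comm] using this b a (le_of_not_ge h)
  convert (integrable_maternFilter_mul_add r (sub_nonneg.2 h)).comp_sub_right a using 4
  ring

theorem integral_maternFilter_sub_mul_sub (r : ℕ) (a b : ℝ) :
    ∫ u, maternFilter r (u - a) * maternFilter r (u - b) =
      ∫ u, maternFilter r u * maternFilter r (u + |a - b|) := by
  wlog h : b ≤ a generalizing a b
  · simpa only [mul_comm (maternFilter r (_ - a)), abs_sub_comm a b] using
      this b a (le_of_not_ge h)
  rw [abs_of_nonneg (sub_nonneg.2 h),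
    ← integral_sub_right_eq_self (fun u => maternFilter r u * maternFilter r (u + (a - b))) a]
  simp only [sub_add_sub_cancel]

theorem maternKernel_eq_integral (r : ℕ) (σ : ℝ) {ℓ : ℝ} (hℓ : 0 < ℓ) (t t' : ℝ) :
    maternKernel r σ ℓ t t' = σ ^ 2 * (2 ^ (2 * r + 1) / (2 * r).factorial) *
      ∫ u, maternFilter r (u - √(2 * r + 1) / ℓ * t) *
        maternFilter r (u - √(2 * r + 1) / ℓ * t') := by
  have hd : |√(2 * r + 1) / ℓ * t - √(2 * r + 1) / ℓ * t'| = √(2 * r + 1) * |t - t'| / ℓ := by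
    rw [← mul_sub, abs_mul, abs_of_nonneg (by positivity)]
    ring
  rw [integral_maternFilter_sub_mul_sub, integral_maternFilter_mul_add r (abs_nonneg _), hd,
    maternKernel, mul_sum, mul_sum]
  refine sum_congr rfl fun i hi => ?_
  have hir : i ≤ r := Nat.lt_succ_iff.1 (mem_range.1 hi)
  rw [show 2 * √(2 * r + 1) * |t - t'| / ℓ = 2 * (√(2 * r + 1) * |t - t'| / ℓ) by ring,
    mul_pow, Nat.cast_choose ℝ hir]
  have hp : (2 : ℝ) ^ (2 * r + 1) = 2 ^ (r - i) * 2 ^ (r + i + 1) := by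
    rw [← pow_add]
    congr 1
    omega
  rw [hp]
  generalize √(2 * r + 1) * |t - t'| / ℓ = d
  field_simp

/-- The half-integer Matérn kernel is a positive semidefinite kernel on `ℝ`: every finite
Gram matrix is positive semidefinite, which makes it a valid Gaussian process covariance
function. -/
theorem maternKernel_posSemidef (r : ℕ) (σ ℓ : ℝ) (hσ : 0 < σ) (hℓ : 0 < ℓ)
    (n : ℕ) (t : Fin n → ℝ) (c : Fin n → ℝ) :
    0 ≤ ∑ i, ∑ j, c i * c j * maternKernel r σ ℓ (t i) (t j) := by
  set f : Fin n → ℝ → ℝ := fun i u => maternFilter r (u - √(2 * r + 1) / ℓ * t i)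
  have hint (i j) : Integrable fun u => c i * c j * (f i u * f j u) :=
    (integrable_maternFilter_sub_mul_sub r _ _).const_mul _
  have key : ∑ i, ∑ j, c i * c j * maternKernel r σ ℓ (t i) (t j) =
      σ ^ 2 * (2 ^ (2 * r + 1) / (2 * r).factorial) * ∫ u, (∑ i, c i * f i u) ^ 2 := by
    have hsq (u : ℝ) : (∑ i, c i * f i u) ^ 2 = ∑ i, ∑ j, c i * c j * (f i u * f j u) := by
      rw [sq, sum_mul_sum]
      exact sum_congr rfl fun i _ => sum_congr rfl fun j _ => by ring
    simp only [hsq]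
    rw [integral_finsetSum _ fun i _ => integrable_finsetSum _ fun j _ => hint i j, mul_sum]
    refine sum_congr rfl fun i _ => ?_
    rw [integral_finsetSum _ fun j _ => hint i j, mul_sum]
    refine sum_congr rfl fun j _ => ?_
    rw [integral_const_mul, maternKernel_eq_integral r σ hℓ]
    ring
  rw [key]
  exact mul_nonneg (by positivity) (integral_nonneg fun u => sq_nonneg _)
end
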